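/- Let (T,Σ,μ) be a measure space with μ(T) < ∞ and F : T ⇉ ℝ^ℓ a nonempty closed-valued lower measurable correspondence that is integrably bounded (there is integrable g with ‖x‖ ≤ g(t) for all x ∈ F(t)). Then the Aumann integral ∫_T F dμ is a nonempty compact subset of ℝ^ℓ. -/

import Mathlib

open MeasureTheory

/-- The Aumann integral of a correspondence: the set of integrals of its
(a.e.) integrable selections. -/
def aumannIntegral {T : Type*} [MeasurableSpace T] (μ : Measure T) {ℓ : ℕ}
    (F : T → Set (Fin ℓ → ℝ)) : Set (Fin ℓ → ℝ) :=
  {y | ∃ f : T → Fin ℓ → ℝ, Integrable f μ ∧ (∀ᵐ t ∂μ, f t ∈ F t) ∧ (∫ t, f t ∂μ) = y}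

open Filter Topology

/-- Every measurable set contains a measurable subset carrying half of the integral of every
member of `S`. -/
def HalvesIntegrals {T : Type*} [MeasurableSpace T] (μ : Measure T) (S : Set (T → ℝ)) : Prop :=
  ∀ A, MeasurableSet A → ∃ B ⊆ A, MeasurableSet B ∧
    ∀ φ ∈ S, ∫ t in B, φ t ∂μ = (∫ t in A, φ t ∂μ) / 2

/-- The dyadic refinement of the pair `∅ ⊆ A`: at level `k + 1` a set built by `h` is inserted
between each two consecutive sets of level `k`. -/
def dyadicChain {T : Type*} (h : Set T → Set T) (A : Set T) : ℕ → ℕ → Set T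
  | 0, j => if j = 0 then ∅ else A
  | k + 1, j =>
    if j % 2 = 0 then dyadicChain h A k (j / 2)
    else dyadicChain h A k (j / 2) ∪ h (dyadicChain h A k (j / 2 + 1) \ dyadicChain h A k (j / 2))

namespace dyadicChain

variable {T : Type*} {h : Set T → Set T} {A : Set T}

theorem zero_right (k : ℕ) : dyadicChain h A k 0 = ∅ := by
  induction k with
  | zero => simp [dyadicChain]
  | succ k ih => simp [dyadicChain, ih]

theorem two_pow_right (k : ℕ) : dyadicChain h A k (2 ^ k) = A := by
  induction k with
  | zero => simp [dyadicChain]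
  | succ k ih => simp [dyadicChain, pow_succ, ih]

theorem succ_two_mul (k j : ℕ) : dyadicChain h A (k + 1) (2 * j) = dyadicChain h A k j := by
  simp [dyadicChain]

theorem monotone (hsub : ∀ B, h B ⊆ B) (k : ℕ) : Monotone (dyadicChain h A k) := by
  refine monotone_nat_of_le_succ fun j => ?_
  induction k generalizing j with
  | zero => simp only [dyadicChain]; split_ifs <;> simp_all
  | succ k ih =>
    simp only [dyadicChain]
    rcases Nat.even_or_odd' j with ⟨i, rfl | rfl⟩
    · have h1 : (2 * i + 1) / 2 = i := by omega
      have h2 : (2 * i + 1) % 2 = 1 := by omega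
      simp [h1]
    · have h1 : (2 * i + 1) / 2 = i := by omega
      have h3 : (2 * i + 1 + 1) / 2 = i + 1 := by omega
      have h4 : (2 * i + 1 + 1) % 2 = 0 := by omega
      simp only [h1, h3, h4]
      simp only [Nat.mul_add_mod_self_left, Nat.one_mod, one_ne_zero, if_false, if_true]
      exact Set.union_subset (ih i) ((hsub _).trans Set.sdiff_subset)

theorem subset (hsub : ∀ B, h B ⊆ B) (k j : ℕ) : dyadicChain h A k j ⊆ A := by
  induction k generalizing j with
  | zero => simp only [dyadicChain]; split_ifs <;> simp
  | succ k ih =>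
    simp only [dyadicChain]
    split_ifs
    · exact ih _
    · exact Set.union_subset (ih _) ((hsub _).trans (Set.sdiff_subset.trans (ih _)))

theorem measurableSet [MeasurableSpace T] (hA : MeasurableSet A)
    (hm : ∀ B, MeasurableSet B → MeasurableSet (h B)) (k j : ℕ) :
    MeasurableSet (dyadicChain h A k j) := by
  induction k generalizing j with
  | zero => simp only [dyadicChain]; split_ifs <;> simp [hA]
  | succ k ih =>
    simp only [dyadicChain]
    split_ifs
    · exact ih _
    · exact (ih _).union (hm _ ((ih _).diff (ih _)))

theorem setIntegral_eq [MeasurableSpace T] {μ : Measure T} {φ : T → ℝ} (hφ : Integrable φ μ)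
    (hA : MeasurableSet A) (hsub : ∀ B, h B ⊆ B) (hm : ∀ B, MeasurableSet B → MeasurableSet (h B))
    (hh : ∀ B, MeasurableSet B → ∫ t in h B, φ t ∂μ = (∫ t in B, φ t ∂μ) / 2)
    (k j : ℕ) (hj : j ≤ 2 ^ k) :
    ∫ t in dyadicChain h A k j, φ t ∂μ = (j / 2 ^ k : ℝ) * ∫ t in A, φ t ∂μ := by
  induction k generalizing j with
  | zero =>
    have : j = 0 ∨ j = 1 := by simp at hj; omega
    rcases this with rfl | rfl <;> simp [dyadicChain]
  | succ k ih =>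
    rw [pow_succ] at hj
    rcases Nat.even_or_odd' j with ⟨i, rfl | rfl⟩
    · rw [succ_two_mul, ih i (by omega)]
      push_cast
      rw [pow_succ]
      field_simp
    · have h1 : (2 * i + 1) / 2 = i := by omega
      have h2 : (2 * i + 1) % 2 = 1 := by omega
      have hmi := measurableSet (h := h) hA hm k
      have hd := (hmi (i + 1)).diff (hmi i)
      simp only [dyadicChain, h1, h2, one_ne_zero, if_false]
      rw [setIntegral_union _ (hm _ hd) hφ.integrableOn hφ.integrableOn, hh _ hd,
        setIntegral_sdiff (hmi i) hφ.integrableOn (monotone hsub k (Nat.le_succ i)),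
        ih i (by omega), ih (i + 1) (by omega)]
      · push_cast
        rw [pow_succ]
        field_simp
        ring
      · exact Set.disjoint_of_subset_right (hsub _) Set.disjoint_sdiff_right

end dyadicChain

theorem HalvesIntegrals.exists_chain {T : Type*} [MeasurableSpace T] {μ : Measure T}
    {S : Set (T → ℝ)} (hS : HalvesIntegrals μ S) (hint : ∀ φ ∈ S, Integrable φ μ) {A : Set T}
    (hA : MeasurableSet A) :
    ∃ D : ℝ → Set T, Monotone D ∧ (∀ s, MeasurableSet (D s)) ∧ (∀ s, D s ⊆ A) ∧ D 0 = ∅ ∧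
      D 1 = A ∧ ∀ s ∈ Set.Icc (0 : ℝ) 1, ∀ φ ∈ S, ∫ t in D s, φ t ∂μ = s * ∫ t in A, φ t ∂μ := by
  classical
  choose! h0 hsub0 hm0 hh0 using hS
  let h : Set T → Set T := fun B => if MeasurableSet B then h0 B else ∅
  have hsub : ∀ B, h B ⊆ B := fun B => by
    by_cases hB : MeasurableSet B <;> simp [h, hB, hsub0]
  have hm : ∀ B, MeasurableSet B → MeasurableSet (h B) := fun B hB => by simp [h, hB, hm0]
  have hh : ∀ φ ∈ S, ∀ B, MeasurableSet B → ∫ t in h B, φ t ∂μ = (∫ t in B, φ t ∂μ) / 2 :=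
    fun φ hφ B hB => by simp only [h, hB, if_true]; exact hh0 B hB φ hφ
  have hmono : ∀ s : ℝ, Monotone fun k => dyadicChain h A k ⌊s * 2 ^ k⌋₊ := fun s =>
    monotone_nat_of_le_succ fun k => by
      rw [← dyadicChain.succ_two_mul]
      refine dyadicChain.monotone hsub _ ?_
      rcases le_or_gt s 0 with hs | hs
      · rw [Nat.floor_of_nonpos (mul_nonpos_of_nonpos_of_nonneg hs (by positivity))]
        simp
      · refine Nat.le_floor ?_
        push_cast
        rw [pow_succ]
        have := Nat.floor_le (a := s * 2 ^ k) (by positivity)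
        linarith
  refine ⟨fun s => ⋃ k, dyadicChain h A k ⌊s * 2 ^ k⌋₊, ?_, ?_, ?_, ?_, ?_, ?_⟩
  · intro s r hsr
    refine Set.iUnion_mono fun k => dyadicChain.monotone hsub _ (Nat.floor_mono ?_)
    gcongr
  · exact fun s => MeasurableSet.iUnion fun k => dyadicChain.measurableSet hA hm _ _
  · exact fun s => Set.iUnion_subset fun k => dyadicChain.subset hsub _ _
  · simp [dyadicChain.zero_right]
  · have : ∀ k : ℕ, ⌊(1 : ℝ) * 2 ^ k⌋₊ = 2 ^ k := fun k => by
      rw [one_mul]; exact_mod_cast Nat.floor_natCast (2 ^ k)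
    simp only [this, dyadicChain.two_pow_right, Set.iUnion_const]
  · intro s hs φ hφ
    have h1 := tendsto_setIntegral_of_monotone (μ := μ) (f := φ)
      (fun k => dyadicChain.measurableSet hA hm k ⌊s * 2 ^ k⌋₊) (hmono s)
      (hint φ hφ).integrableOn
    refine tendsto_nhds_unique h1 ?_
    have h2 : Tendsto (fun k : ℕ => (⌊s * 2 ^ k⌋₊ : ℝ) / 2 ^ k) atTop (𝓝 s) :=
      (tendsto_nat_floor_mul_div_atTop hs.1).comp (tendsto_pow_atTop_atTop_of_one_lt one_lt_two)
    refine (h2.mul_const _).congr fun k => ?_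
    rw [dyadicChain.setIntegral_eq (hint φ hφ) hA hsub hm (hh φ hφ)]
    refine Nat.floor_le_of_le ?_
    push_cast
    nlinarith [hs.2, pow_pos (zero_lt_two' ℝ) k]

theorem HalvesIntegrals.insert {T : Type*} [MeasurableSpace T] {μ : Measure T}
    [IsFiniteMeasure μ] {S : Set (T → ℝ)} (hS : HalvesIntegrals μ S)
    (hint : ∀ φ ∈ S, Integrable φ μ) (h1 : (fun _ => 1) ∈ S) {ψ : T → ℝ} (hψ : Integrable ψ μ) :
    HalvesIntegrals μ (insert ψ S) := by
  intro A hA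
  have key : ∀ {A : Set T} {D : ℝ → Set T}, Monotone D → (∀ s, MeasurableSet (D s)) →
      (∀ s ∈ Set.Icc (0 : ℝ) 1, ∀ φ ∈ S, ∫ t in D s, φ t ∂μ = s * ∫ t in A, φ t ∂μ) →
      ContinuousOn (fun s => ∫ t in D s, ψ t ∂μ) (Set.Icc 0 1) := by
    intro A D hmono hm hD s hs
    have hdiff : ∀ r ∈ Set.Icc (0 : ℝ) 1,
        μ.real (D (max r s) \ D (min r s)) = |r - s| * μ.real A := by
      intro r hr
      have hmeas : ∀ u ∈ Set.Icc (0 : ℝ) 1, μ.real (D u) = u * μ.real A := fun u hu => by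
        simpa using hD u hu _ h1
      rw [measureReal_sdiff (hmono min_le_max) (hm _),
        hmeas _ ⟨le_max_of_le_left hr.1, max_le hr.2 hs.2⟩,
        hmeas _ ⟨le_min hr.1 hs.1, min_le_of_left_le hr.2⟩, ← sub_mul, max_sub_min_eq_abs,
        abs_sub_comm]
    have hz : Tendsto (fun r => μ (D (max r s) \ D (min r s))) (𝓝[Set.Icc 0 1] s) (𝓝 0) := by
      rw [← ENNReal.tendsto_toReal_iff (fun _ => measure_ne_top _ _) ENNReal.zero_ne_top]
      have : Tendsto (fun r : ℝ => |r - s| * μ.real A) (𝓝[Set.Icc 0 1] s) (𝓝 0) := by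
        have hc : Continuous fun r : ℝ => |r - s| * μ.real A := by fun_prop
        simpa using (hc.tendsto s).mono_left nhdsWithin_le_nhds
      refine this.congr' ?_
      filter_upwards [self_mem_nhdsWithin] with r hr using (hdiff r hr).symm
    have hz' := (hψ.tendsto_setIntegral_nhds_zero hz).abs
    rw [abs_zero] at hz'
    rw [ContinuousWithinAt, tendsto_iff_norm_sub_tendsto_zero]
    refine hz'.congr fun r => ?_
    rw [setIntegral_sdiff (hm _) hψ.integrableOn (hmono min_le_max)]
    rcases le_total r s with h | h
    · simp only [max_eq_right h, min_eq_left h, Real.norm_eq_abs]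
      rw [abs_sub_comm]
    · simp only [max_eq_left h, min_eq_right h, Real.norm_eq_abs]
  obtain ⟨B, hBA, hB, hBS⟩ := hS A hA
  have hAB := hA.diff hB
  obtain ⟨D, hDm, hDmeas, hDsub, hD0, hD1, hD⟩ := hS.exists_chain hint hB
  obtain ⟨D', hDm', hDmeas', hDsub', hD0', hD1', hD'⟩ := hS.exists_chain hint hAB
  have hdisj : ∀ s r, Disjoint (D s) (D' r) := fun s r =>
    Set.disjoint_of_subset (hDsub s) (hDsub' r) Set.disjoint_sdiff_right
  have hunion : ∀ φ : T → ℝ, Integrable φ μ → ∀ s r,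
      ∫ t in D s ∪ D' r, φ t ∂μ = ∫ t in D s, φ t ∂μ + ∫ t in D' r, φ t ∂μ := fun φ hφ s r =>
    setIntegral_union (hdisj s r) (hDmeas' r) hφ.integrableOn hφ.integrableOn
  have hrefl : Set.MapsTo (fun s : ℝ => 1 - s) (Set.Icc 0 1) (Set.Icc 0 1) := fun s hs =>
    ⟨by linarith [hs.2], by linarith [hs.1]⟩
  have hcont : ContinuousOn (fun s => ∫ t in D (1 - s) ∪ D' s, ψ t ∂μ) (Set.Icc 0 1) := by
    simp only [hunion ψ hψ]
    exact ((key hDm hDmeas hD).comp (by fun_prop) hrefl).add (key hDm' hDmeas' hD')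
  have hsum := setIntegral_sdiff hB hψ.integrableOn (f := ψ) hBA
  have hpre : (∫ t in A, ψ t ∂μ) / 2 ∈ (fun s => ∫ t in D (1 - s) ∪ D' s, ψ t ∂μ) ''
      Set.Icc (0 : ℝ) 1 := by
    rcases le_total (∫ t in B, ψ t ∂μ) (∫ t in A \ B, ψ t ∂μ) with hle | hle
    · refine intermediate_value_Icc zero_le_one hcont ?_
      simp only [sub_zero, sub_self, hD0, hD1, hD0', hD1', Set.union_empty, Set.empty_union]
      constructor <;> linarith
    · refine intermediate_value_Icc' zero_le_one hcont ?_
      simp only [sub_zero, sub_self, hD0, hD1, hD0', hD1', Set.union_empty, Set.empty_union]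
      constructor <;> linarith
  obtain ⟨s, hs, hsψ⟩ := hpre
  refine ⟨D (1 - s) ∪ D' s, Set.union_subset ((hDsub _).trans hBA)
    ((hDsub' _).trans Set.sdiff_subset), (hDmeas _).union (hDmeas' _), ?_⟩
  rintro φ (rfl | hφ)
  · exact hsψ
  · rw [hunion φ (hint φ hφ), hD _ (hrefl hs) φ hφ, hD' s hs φ hφ,
      setIntegral_sdiff hB (hint φ hφ).integrableOn hBA, hBS φ hφ]
    ring

theorem HalvesIntegrals.insert_one_of_finite {T : Type*} [MeasurableSpace T] {μ : Measure T}
    [IsFiniteMeasure μ] (h : HalvesIntegrals μ {fun _ => 1}) {S : Set (T → ℝ)} (hfin : S.Finite)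
    (hint : ∀ φ ∈ S, Integrable φ μ) : HalvesIntegrals μ (Insert.insert (fun _ => 1) S) := by
  induction S, hfin using Set.Finite.induction_on with
  | empty => simpa using h
  | @insert ψ S _ _ ih =>
    rw [Set.insert_comm]
    have hS := fun φ hφ => hint φ (Set.mem_insert_of_mem _ hφ)
    refine (ih hS).insert ?_ (Set.mem_insert _ _) (hint ψ (Set.mem_insert _ _))
    rintro φ (rfl | hφ)
    · exact integrable_const 1
    · exact hS φ hφ

/-- **Lyapunov's convexity theorem**: if `μ` is nonatomic, the range of a finite-dimensional
vector measure with a density with respect to `μ` contains the segment from `0` to its total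
mass. -/
theorem HalvesIntegrals.exists_setIntegral_eq_smul {T E : Type*} [MeasurableSpace T]
    {μ : Measure T} [IsFiniteMeasure μ] [NormedAddCommGroup E] [NormedSpace ℝ E]
    [FiniteDimensional ℝ E] (h : HalvesIntegrals μ {fun _ => 1}) {φ : T → E}
    (hφ : Integrable φ μ) {s : ℝ} (hs : s ∈ Set.Icc (0 : ℝ) 1) :
    ∃ A, MeasurableSet A ∧ ∫ t in A, φ t ∂μ = s • ∫ t, φ t ∂μ := by
  have : CompleteSpace E := FiniteDimensional.complete ℝ E
  let b := Module.finBasis ℝ E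
  let p : Fin (Module.finrank ℝ E) → E →L[ℝ] ℝ := fun i =>
    LinearMap.toContinuousLinearMap (b.coord i)
  have hint : ∀ ψ ∈ Set.range fun i t => p i (φ t), Integrable ψ μ := by
    rintro _ ⟨i, rfl⟩
    exact (p i).integrable_comp hφ
  obtain ⟨D, -, hDm, -, -, -, hD⟩ :=
    (h.insert_one_of_finite (Set.finite_range _) hint).exists_chain
    (by
      rintro ψ (rfl | hψ)
      · exact integrable_const 1
      · exact hint ψ hψ) MeasurableSet.univ
  refine ⟨D s, hDm s, b.ext_elem fun i => ?_⟩
  have := hD s hs _ (Set.mem_insert_of_mem _ ⟨i, rfl⟩)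
  rw [setIntegral_univ, (p i).integral_comp_comm hφ,
    (p i).integral_comp_comm hφ.integrableOn] at this
  simpa [p] using this

theorem halvesIntegrals_one_of_nullSingletonClass (μ : Measure ℝ) [IsFiniteMeasure μ]
    [NullSingletonClass μ] : HalvesIntegrals μ {fun _ => 1} := by
  intro A hA
  let ν := μ.restrict A
  suffices ∃ s, ν.real (Set.Iic s) = ν.real Set.univ / 2 by
    obtain ⟨s, hs⟩ := this
    refine ⟨A ∩ Set.Iic s, Set.inter_subset_left, hA.inter measurableSet_Iic, ?_⟩
    rintro _ rfl
    simpa [ν, measureReal_restrict_apply, measurableSet_Iic, Set.inter_comm] using hs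
  rcases eq_or_ne (ν.real Set.univ) 0 with h0 | h0
  · exact ⟨0, by rw [h0, zero_div]; exact measureReal_mono_null (Set.subset_univ _) h0⟩
  have hpos : 0 < ν.real Set.univ := lt_of_le_of_ne measureReal_nonneg h0.symm
  have hcont : Continuous fun s => ν.real (Set.Iic s) := by
    have h := intervalIntegral.continuous_primitive (μ := ν) (f := fun _ => (1 : ℝ))
      (fun a b => intervalIntegrable_const) 0
    have h2 : (fun s => ν.real (Set.Iic s)) = fun s => (∫ _ in (0 : ℝ)..s, (1 : ℝ) ∂ν) +
        ν.real (Set.Iic 0) := by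
      ext s
      have := intervalIntegral.integral_Iic_sub_Iic (μ := ν) (f := fun _ : ℝ => (1 : ℝ))
        (a := 0) (b := s) (integrable_const _).integrableOn (integrable_const _).integrableOn
      rw [← this]
      simp
    rw [h2]
    exact h.add continuous_const
  have htop : Tendsto (fun s => ν.real (Set.Iic s)) atTop (𝓝 (ν.real Set.univ)) :=
    (ENNReal.tendsto_toReal (measure_ne_top _ _)).comp (tendsto_measure_Iic_atTop ν)
  have hbot : Tendsto (fun s => ν.real (Set.Iic s)) atBot (𝓝 0) := by
    have h := ((ENNReal.tendsto_toReal (measure_ne_top _ _)).comp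
      (tendsto_measure_Ici_atBot ν)).const_sub (ν.real Set.univ)
    rw [← Measure.real, sub_self] at h
    refine h.congr fun s => ?_
    rw [← measureReal_congr Iio_ae_eq_Iic, ← Set.compl_Ici, measureReal_compl measurableSet_Ici]
    rfl
  obtain ⟨a, ha⟩ := (hbot.eventually_lt_const (half_pos hpos)).exists
  obtain ⟨b, hb⟩ := (htop.eventually_const_lt (half_lt_self hpos)).exists
  exact mem_range_of_exists_le_of_exists_ge hcont ⟨a, ha.le⟩ ⟨b, hb.le⟩

/-- The point `x` is the limit of the values of `u` along some indices tending to infinity. -/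
def IsSubseqLimit {E : Type*} [TopologicalSpace E] (x : E) (u : ℕ → E) : Prop :=
  ∃ σ : ℕ → ℕ, Tendsto σ atTop atTop ∧ Tendsto (fun j => u (σ j)) atTop (𝓝 x)

theorem IsSubseqLimit.mem_of_isClosed {E : Type*} [TopologicalSpace E] {x : E} {u : ℕ → E}
    (h : IsSubseqLimit x u) {K : Set E} (hK : IsClosed K) (hu : ∀ n, u n ∈ K) : x ∈ K := by
  obtain ⟨σ, -, hσ⟩ := h
  exact hK.mem_of_tendsto hσ (Eventually.of_forall fun j => hu _)

theorem IsSubseqLimit.norm_le {E : Type*} [NormedAddCommGroup E] {x : E} {u : ℕ → E} {C : ℝ}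
    (h : IsSubseqLimit x u) (hu : ∀ n, ‖u n‖ ≤ C) : ‖x‖ ≤ C := by
  simpa using h.mem_of_isClosed (Metric.isClosed_closedBall (x := (0 : E)) (ε := C))
    (by simpa using hu)

theorem IsSubseqLimit.of_comp {E : Type*} [TopologicalSpace E] {x : E} {u : ℕ → E} {σ : ℕ → ℕ}
    (hσ : Tendsto σ atTop atTop) (h : IsSubseqLimit x (fun n => u (σ n))) : IsSubseqLimit x u := by
  obtain ⟨τ, hτ, hlim⟩ := h
  exact ⟨fun j => σ (τ j), hσ.comp hτ, hlim⟩

theorem IsSubseqLimit.eq_of_tendsto {E : Type*} [TopologicalSpace E] [T2Space E] {x y : E}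
    {u : ℕ → E} (h : IsSubseqLimit x u) (hu : Tendsto u atTop (𝓝 y)) : x = y := by
  obtain ⟨σ, hσ, hlim⟩ := h
  exact tendsto_nhds_unique hlim (hu.comp hσ)

theorem IsSubseqLimit.map {E E' : Type*} [TopologicalSpace E] [TopologicalSpace E'] {x : E}
    {u : ℕ → E} (h : IsSubseqLimit x u) {f : E → E'} (hf : Continuous f) :
    IsSubseqLimit (f x) (fun n => f (u n)) := by
  obtain ⟨σ, hσ, hlim⟩ := h
  exact ⟨σ, hσ, (hf.tendsto x).comp hlim⟩

theorem measurable_apply_index {T E : Type*} [MeasurableSpace T] [MeasurableSpace E]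
    {k : ℕ → T → E} (hk : ∀ n, Measurable (k n)) {σ : T → ℕ} (hσ : Measurable σ) :
    Measurable fun t => k (σ t) t :=
  (measurable_from_prod_countable_right (f := fun q : ℕ × T => k q.1 q.2) hk).comp
    (hσ.prodMk measurable_id)

theorem exists_measurable_index_tendsto_limsup {T : Type*} [MeasurableSpace T] {a : ℕ → T → ℝ}
    (ha : ∀ n, Measurable (a n)) (hb : ∀ t, ∃ C, ∀ n, |a n t| ≤ C) :
    ∃ σ : ℕ → T → ℕ, (∀ j, Measurable (σ j)) ∧ (∀ j t, j ≤ σ j t) ∧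
      ∀ t, Tendsto (fun j => a (σ j t) t) atTop (𝓝 (limsup (fun n => a n t) atTop)) := by
  classical
  have hm : Measurable fun t => limsup (fun n => a n t) atTop := Measurable.limsup ha
  have hex : ∀ (j : ℕ) t, ∃ n, j ≤ n ∧ |a n t - limsup (fun n => a n t) atTop| < 1 / (j + 1) := by
    intro j t
    obtain ⟨C, hC⟩ := hb t
    have hε : (0 : ℝ) < 1 / (j + 1) := by positivity
    have hbdd : IsBoundedUnder (· ≤ ·) atTop fun n => a n t :=
      isBoundedUnder_of ⟨C, fun n => (abs_le.1 (hC n)).2⟩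
    have hcobdd : IsCoboundedUnder (· ≤ ·) atTop fun n => a n t :=
      (isBoundedUnder_of ⟨-C, fun n => (abs_le.1 (hC n)).1⟩ :
        IsBoundedUnder (· ≥ ·) atTop fun n => a n t).isCoboundedUnder_le
    have h1 := eventually_lt_of_limsup_lt (lt_add_of_pos_right _ hε) hbdd
    have h2 := frequently_lt_of_lt_limsup hcobdd (sub_lt_self _ hε)
    obtain ⟨n, hn, hlt, hj⟩ := (h2.and_eventually (h1.and (eventually_ge_atTop j))).exists
    exact ⟨n, hj, abs_lt.2 ⟨by linarith, by linarith⟩⟩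
  refine ⟨fun j t => Nat.find (hex j t), fun j => measurable_find _ fun n => ?_,
    fun j t => (Nat.find_spec (hex j t)).1, fun t => ?_⟩
  · exact (MeasurableSet.const _).inter
      (measurableSet_lt ((ha n).sub hm).abs measurable_const)
  · rw [tendsto_iff_norm_sub_tendsto_zero]
    exact squeeze_zero (fun _ => norm_nonneg _) (fun j => (Nat.find_spec (hex j t)).2.le)
      tendsto_one_div_add_atTop_nhds_zero_nat

theorem exists_measurable_index_tendsto {ι T : Type*} [MeasurableSpace T] (s : Finset ι)
    {a : ι → ℕ → T → ℝ} (ha : ∀ i n, Measurable (a i n))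
    (hb : ∀ i t, ∃ C, ∀ n, |a i n t| ≤ C) :
    ∃ σ : ℕ → T → ℕ, (∀ j, Measurable (σ j)) ∧ (∀ j t, j ≤ σ j t) ∧
      ∀ i ∈ s, ∀ t, ∃ c, Tendsto (fun j => a i (σ j t) t) atTop (𝓝 c) := by
  classical
  induction s using Finset.induction_on with
  | empty => exact ⟨fun j _ => j, fun j => measurable_const, fun _ _ => le_rfl, by simp⟩
  | insert i s _ ih =>
    obtain ⟨σ, hσm, hσ, hlim⟩ := ih
    obtain ⟨τ, hτm, hτ, hlim'⟩ := exists_measurable_index_tendsto_limsup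
      (a := fun j t => a i (σ j t) t) (fun j => measurable_apply_index (ha i) (hσm j))
      (fun t => (hb i t).imp fun C hC j => hC _)
    refine ⟨fun j t => σ (τ j t) t, fun j => measurable_apply_index hσm (hτm j),
      fun j t => (hτ j t).trans (hσ _ _), fun i' hi' t => ?_⟩
    rcases Finset.mem_insert.1 hi' with rfl | hi'
    · exact ⟨_, hlim' t⟩
    · obtain ⟨c, hc⟩ := hlim i' hi' t
      exact ⟨c, hc.comp (tendsto_atTop_mono (fun j => hτ j t) tendsto_id)⟩

theorem Convex.exists_ne_zero_forall_le {E : Type*} [NormedAddCommGroup E]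
    [NormedSpace ℝ E] [FiniteDimensional ℝ E] {C : Set E} (hC : Convex ℝ C) (hne : C.Nonempty)
    {y : E} (hy : y ∉ C) : ∃ p : E →L[ℝ] ℝ, p ≠ 0 ∧ ∀ c ∈ C, p c ≤ p y := by
  rcases (interior C).eq_empty_or_nonempty with hint | hint
  · have hspan : affineSpan ℝ C ≠ ⊤ := fun h => by
      rw [← hC.interior_nonempty_iff_affineSpan_eq_top, hint] at h
      exact Set.not_nonempty_empty h
    have hdir : vectorSpan ℝ C ≠ ⊤ := fun h => hspan <| by
      rwa [← AffineSubspace.direction_eq_top_iff_of_nonempty ((affineSpan_nonempty ℝ).2 hne),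
        direction_affineSpan]
    obtain ⟨f, hf, hker⟩ := Submodule.exists_le_ker_of_lt_top _ hdir.lt_top
    obtain ⟨c₀, hc₀⟩ := hne
    have hconst : ∀ c ∈ C, f c = f c₀ := fun c hc => by
      have := hker (vsub_mem_vectorSpan ℝ hc hc₀)
      rwa [vsub_eq_sub, LinearMap.mem_ker, map_sub, sub_eq_zero] at this
    have hp : LinearMap.toContinuousLinearMap f ≠ 0 := fun h => hf <| by
      simpa using h
    rcases le_total (f c₀) (f y) with h | h
    · exact ⟨LinearMap.toContinuousLinearMap f, hp, fun c hc => by simpa [hconst c hc] using h⟩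
    · exact ⟨-LinearMap.toContinuousLinearMap f, neg_ne_zero.2 hp, fun c hc => by
        simpa [hconst c hc] using h⟩
  · obtain ⟨p, hp⟩ := geometric_hahn_banach_open_point hC.interior isOpen_interior
      fun h => hy (interior_subset h)
    refine ⟨p, ?_, fun c hc => ?_⟩
    · rintro rfl
      obtain ⟨a, ha⟩ := hint
      simpa using hp a ha
    · have hcl : closure (interior C) ⊆ {c | p c ≤ p y} :=
        closure_minimal (fun a ha => (hp a ha).le) (isClosed_le p.continuous continuous_const)
      rw [hC.closure_interior_eq_closure_of_nonempty_interior hint] at hcl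
      exact hcl (subset_closure hc)

section FiniteDimensional

variable {T E : Type*} [MeasurableSpace T] [NormedAddCommGroup E] [NormedSpace ℝ E]
  [FiniteDimensional ℝ E] [MeasurableSpace E] [BorelSpace E]

theorem exists_measurable_isSubseqLimit {k : ℕ → T → E} (hk : ∀ n, Measurable (k n))
    (hb : ∀ t, ∃ C, ∀ n, ‖k n t‖ ≤ C) :
    ∃ f : T → E, Measurable f ∧ ∀ t, IsSubseqLimit (f t) (fun n => k n t) := by
  let b := Module.finBasis ℝ E
  let p : Fin (Module.finrank ℝ E) → E →L[ℝ] ℝ := fun i =>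
    LinearMap.toContinuousLinearMap (b.coord i)
  obtain ⟨σ, hσm, hσ, hlim⟩ := exists_measurable_index_tendsto Finset.univ
    (a := fun i n t => p i (k n t)) (fun i n => (p i).continuous.measurable.comp (hk n))
    (fun i t => by
      obtain ⟨C, hC⟩ := hb t
      exact ⟨‖p i‖ * C, fun n => ((p i).le_opNorm _).trans
        (mul_le_mul_of_nonneg_left (hC n) (norm_nonneg _))⟩)
  choose c hc using fun i => hlim i (Finset.mem_univ i)
  have hf : ∀ t, Tendsto (fun j => k (σ j t) t) atTop (𝓝 (∑ i, c i t • b i)) := fun t => by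
    have := tendsto_finsetSum Finset.univ fun i _ => (hc i t).smul_const (b i)
    refine this.congr fun j => ?_
    exact b.sum_repr _
  refine ⟨fun t => ∑ i, c i t • b i, ?_, fun t => ⟨fun j => σ j t, ?_, hf t⟩⟩
  · exact measurable_of_tendsto_metrizable (fun j => measurable_apply_index hk (hσm j))
      (tendsto_pi_nhds.2 hf)
  · exact tendsto_atTop_mono (fun j => hσ j t) tendsto_id

theorem exists_measurable_isSubseqLimit_map_eq_limsup {k : ℕ → T → E}
    (hk : ∀ n, Measurable (k n)) (hb : ∀ t, ∃ C, ∀ n, ‖k n t‖ ≤ C) (p : E →L[ℝ] ℝ) :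
    ∃ f : T → E, Measurable f ∧ (∀ t, IsSubseqLimit (f t) (fun n => k n t)) ∧
      ∀ t, p (f t) = limsup (fun n => p (k n t)) atTop := by
  obtain ⟨σ, hσm, hσ, hlim⟩ := exists_measurable_index_tendsto_limsup
    (a := fun n t => p (k n t)) (fun n => p.continuous.measurable.comp (hk n))
    (fun t => by
      obtain ⟨C, hC⟩ := hb t
      exact ⟨‖p‖ * C, fun n => (p.le_opNorm _).trans
        (mul_le_mul_of_nonneg_left (hC n) (norm_nonneg _))⟩)
  obtain ⟨f, hfm, hf⟩ := exists_measurable_isSubseqLimit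
    (fun j => measurable_apply_index hk (hσm j)) (fun t => (hb t).imp fun C hC j => hC _)
  exact ⟨f, hfm, fun t => (hf t).of_comp (tendsto_atTop_mono (fun j => hσ j t) tendsto_id),
    fun t => ((hf t).map p.continuous).eq_of_tendsto (hlim t)⟩

/-- A pointwise bounded case of the **Kuratowski–Ryll-Nardzewski selection theorem**. -/
theorem exists_measurable_selection {F : T → Set E} (hne : ∀ t, (F t).Nonempty)
    (hcl : ∀ t, IsClosed (F t))
    (hlm : ∀ V : Set E, IsOpen V → MeasurableSet {t | (F t ∩ V).Nonempty})
    (hbd : ∀ t, ∃ C, ∀ x ∈ F t, ‖x‖ ≤ C) :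
    ∃ f : T → E, Measurable f ∧ ∀ t, f t ∈ F t := by
  classical
  let q := TopologicalSpace.denseSeq E
  have hε : ∀ j : ℕ, (0 : ℝ) < 1 / (j + 1) := fun j => by positivity
  have hex : ∀ (j : ℕ) t, ∃ i, (F t ∩ Metric.ball (q i) (1 / (j + 1))).Nonempty := fun j t => by
    obtain ⟨x, hx⟩ := hne t
    obtain ⟨i, hi⟩ := (TopologicalSpace.denseRange_denseSeq E).exists_dist_lt x (hε j)
    exact ⟨i, x, hx, hi⟩
  let k : ℕ → T → E := fun j t => q (Nat.find (hex j t))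
  have hkx : ∀ j t, ∃ x ∈ F t, dist x (k j t) < 1 / (j + 1) := fun j t => Nat.find_spec (hex j t)
  obtain ⟨f, hfm, hf⟩ := exists_measurable_isSubseqLimit (k := k)
    (fun j => measurable_from_nat.comp
      (measurable_find _ fun i => hlm _ Metric.isOpen_ball))
    (fun t => by
      obtain ⟨C, hC⟩ := hbd t
      refine ⟨C + 1, fun j => ?_⟩
      obtain ⟨x, hx, hxk⟩ := hkx j t
      have h1 : (1 : ℝ) / (j + 1) ≤ 1 := by
        rw [div_le_one (by positivity)]
        linarith [(Nat.cast_nonneg j : (0 : ℝ) ≤ j)]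
      have h2 := norm_le_norm_add_norm_sub x (k j t)
      rw [dist_eq_norm] at hxk
      linarith [hC x hx])
  refine ⟨f, hfm, fun t => ?_⟩
  have h0 : Tendsto (fun j => Metric.infDist (k j t) (F t)) atTop (𝓝 0) :=
    squeeze_zero (fun _ => Metric.infDist_nonneg) (fun j => by
      obtain ⟨x, hx, hxk⟩ := hkx j t
      rw [dist_comm] at hxk
      exact (Metric.infDist_le_dist_of_mem hx).trans hxk.le) tendsto_one_div_add_atTop_nhds_zero_nat
  rw [(hcl t).mem_iff_infDist_zero (hne t)]
  exact ((hf t).map (Metric.continuous_infDist_pt _)).eq_of_tendsto h0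

end FiniteDimensional

theorem HalvesIntegrals.exists_isSubseqLimit_integral_eq {T : Type*} [MeasurableSpace T]
    {μ : Measure T} [IsFiniteMeasure μ] (hμ : HalvesIntegrals μ {fun _ => 1}) (d : ℕ) :
    ∀ {E : Type*} [NormedAddCommGroup E] [NormedSpace ℝ E] [FiniteDimensional ℝ E]
      [MeasurableSpace E] [BorelSpace E], Module.finrank ℝ E = d →
      ∀ {k : ℕ → T → E} {g : T → ℝ} {y : E}, (∀ n, Measurable (k n)) → Integrable g μ →
      (∀ n t, ‖k n t‖ ≤ g t) → Tendsto (fun n => ∫ t, k n t ∂μ) atTop (𝓝 y) →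
      ∃ f : T → E, Measurable f ∧ (∀ᵐ t ∂μ, IsSubseqLimit (f t) fun n => k n t) ∧
        ∫ t, f t ∂μ = y := by
  induction d using Nat.strong_induction_on with
  | _ d ih =>
  intro E _ _ _ _ _ hd k g y hk hg hkg hy
  have : CompleteSpace E := FiniteDimensional.complete ℝ E
  have hint : ∀ f : T → E, Measurable f → (∀ᵐ t ∂μ, IsSubseqLimit (f t) fun n => k n t) →
      Integrable f μ := fun f hf hlim =>
    hg.mono' hf.aestronglyMeasurable (hlim.mono fun t ht => ht.norm_le fun n => hkg n t)
  let C : Set E := {c | ∃ f : T → E, Measurable f ∧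
    (∀ᵐ t ∂μ, IsSubseqLimit (f t) fun n => k n t) ∧ ∫ t, f t ∂μ = c}
  have hCne : C.Nonempty := by
    obtain ⟨f, hfm, hf⟩ := exists_measurable_isSubseqLimit hk fun t => ⟨g t, fun n => hkg n t⟩
    exact ⟨_, f, hfm, ae_of_all _ hf, rfl⟩
  have hC : Convex ℝ C := by
    classical
    rintro _ ⟨f₀, hm₀, hf₀, rfl⟩ _ ⟨f₁, hm₁, hf₁, rfl⟩ a b ha hb hab
    obtain rfl : b = 1 - a := by linarith
    have hi₀ := hint f₀ hm₀ hf₀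
    have hi₁ := hint f₁ hm₁ hf₁
    obtain ⟨A, hA, hAφ⟩ := hμ.exists_setIntegral_eq_smul (hi₀.sub hi₁)
      (s := a) ⟨ha, by linarith⟩
    refine ⟨A.piecewise f₀ f₁, hm₀.piecewise hA hm₁, ?_, ?_⟩
    · filter_upwards [hf₀, hf₁] with t h₀ h₁
      by_cases ht : t ∈ A <;> simp [ht, h₀, h₁]
    · rw [integral_piecewise hA hi₀.integrableOn hi₁.integrableOn]
      simp only [Pi.sub_apply] at hAφ
      rw [integral_sub hi₀.integrableOn hi₁.integrableOn, integral_sub hi₀ hi₁] at hAφ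
      have h₁ := integral_add_compl hA hi₁
      rw [← eq_sub_iff_add_eq'] at h₁
      rw [sub_eq_iff_eq_add] at hAφ
      rw [hAφ, h₁]
      module
  by_cases hyC : y ∈ C
  · exact hyC
  obtain ⟨p, hp, hpC⟩ := hC.exists_ne_zero_forall_le hCne hyC
  have hpk : ∀ n t, |p (k n t)| ≤ ‖p‖ * g t := fun n t =>
    (p.le_opNorm _).trans (mul_le_mul_of_nonneg_left (hkg n t) (norm_nonneg _))
  have hki : ∀ n, Integrable (k n) μ := fun n =>
    hg.mono' (hk n).aestronglyMeasurable (ae_of_all _ (hkg n))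
  obtain ⟨f, hfm, hf, hfp⟩ := exists_measurable_isSubseqLimit_map_eq_limsup hk
    (fun t => ⟨g t, fun n => hkg n t⟩) p
  have hfi := hint f hfm (ae_of_all _ hf)
  let m : T → ℝ := fun t => p (f t)
  have hmi : Integrable m μ := p.integrable_comp hfi
  have hmeas : Measurable m := p.continuous.measurable.comp hfm
  have hmg : ∀ t, |m t| ≤ ‖p‖ * g t := fun t =>
    (p.le_opNorm _).trans (mul_le_mul_of_nonneg_left ((hf t).norm_le fun n => hkg n t)
      (norm_nonneg _))
  have hmy : ∫ t, m t ∂μ ≤ p y := by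
    rw [p.integral_comp_comm hfi]
    exact hpC _ ⟨f, hfm, ae_of_all _ hf, rfl⟩
  have hpki : ∀ n, Integrable (fun t => p (k n t)) μ := fun n => p.integrable_comp (hki n)
  have hpy : Tendsto (fun n => ∫ t, p (k n t) ∂μ) atTop (𝓝 (p y)) := by
    simp only [fun n => p.integral_comp_comm (hki n)]
    exact (p.continuous.tendsto y).comp hy
  have hmax : Tendsto (fun n => ∫ t, max (p (k n t)) (m t) ∂μ) atTop (𝓝 (∫ t, m t ∂μ)) := by
    refine tendsto_integral_of_dominated_convergence (fun t => ‖p‖ * g t)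
      (fun n => ((hpki n).sup hmi).aestronglyMeasurable) (hg.const_mul _)
      (fun n => ae_of_all _ fun t => abs_max_le_max_abs_abs.trans (max_le (hpk n t) (hmg t)))
      (ae_of_all _ fun t => ?_)
    refine tendsto_order.2 ⟨fun a ha => Eventually.of_forall fun n => lt_max_of_lt_right ha,
      fun a ha => ?_⟩
    have hlt : limsup (fun n => p (k n t)) atTop < a := by rwa [← hfp]
    filter_upwards [eventually_lt_of_limsup_lt hlt (isBoundedUnder_of
      ⟨_, fun n => (abs_le.1 (hpk n t)).2⟩)] with n hn
    exact max_lt hn ha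
  have hpm : p y = ∫ t, m t ∂μ :=
    le_antisymm (le_of_tendsto_of_tendsto' hpy hmax fun n =>
      integral_mono (hpki n) ((hpki n).sup hmi) fun t => le_max_left _ _) hmy
  have hL1 : Tendsto (fun n => ∫ t, |p (k n t) - m t| ∂μ) atTop (𝓝 0) := by
    have h := ((hmax.sub_const (∫ t, m t ∂μ)).const_mul 2).sub (hpy.sub_const (∫ t, m t ∂μ))
    rw [hpm] at h
    simp only [sub_self, mul_zero] at h
    refine h.congr fun n => ?_
    have hsup : Integrable (fun t => max (p (k n t)) (m t)) μ := (hpki n).sup hmi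
    have hdiff₁ : Integrable (fun t => 2 * (max (p (k n t)) (m t) - m t)) μ :=
      (hsup.sub hmi).const_mul 2
    have hdiff₂ : Integrable (fun t => p (k n t) - m t) μ := (hpki n).sub hmi
    rw [← integral_sub hsup hmi, ← integral_sub (hpki n) hmi,
      ← integral_const_mul, ← integral_sub hdiff₁ hdiff₂]
    refine integral_congr_ae (ae_of_all _ fun t => ?_)
    rcases le_total (p (k n t)) (m t) with h | h
    · simp only [max_eq_right h, abs_of_nonpos (sub_nonpos.2 h)]
      ring
    · simp only [max_eq_left h, abs_of_nonneg (sub_nonneg.2 h)]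
      ring
  obtain ⟨φ, hφ, hφlim⟩ : ∃ φ : ℕ → ℕ, StrictMono φ ∧
      ∀ᵐ t ∂μ, Tendsto (fun n => p (k (φ n) t)) atTop (𝓝 (m t)) := by
    refine TendstoInMeasure.exists_seq_tendsto_ae (f := fun n t => p (k n t))
      (tendstoInMeasure_of_tendsto_eLpNorm one_ne_zero
        (fun n => (hpki n).aestronglyMeasurable) hmi.aestronglyMeasurable ?_)
    have : ∀ n, eLpNorm ((fun t => p (k n t)) - m) 1 μ =
        ENNReal.ofReal (∫ t, |p (k n t) - m t| ∂μ) := fun n => by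
      rw [eLpNorm_one_eq_lintegral_enorm]
      exact (ofReal_integral_norm_eq_lintegral_enorm ((hpki n).sub hmi)).symm
    simp only [this]
    simpa using ENNReal.tendsto_ofReal hL1
  obtain ⟨v, hv⟩ : ∃ v, p v = 1 := by
    obtain ⟨w, hw⟩ : ∃ w, p w ≠ 0 := by
      by_contra! h
      exact hp (ContinuousLinearMap.ext h)
    exact ⟨(p w)⁻¹ • w, by simp [hw]⟩
  let K : Submodule ℝ E := LinearMap.ker p.toLinearMap
  let π : E →L[ℝ] K := (ContinuousLinearMap.id ℝ E - p.smulRight v).codRestrict K fun x => by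
    simp [K, hv]
  have hπ : ∀ x, (π x : E) = x - p x • v := fun x => rfl
  have hrank : Module.finrank ℝ K < d := by
    rw [← hd]
    refine Submodule.finrank_lt fun h => ?_
    have hvK : v ∈ K := h ▸ Submodule.mem_top
    have : p v = 0 := hvK
    exact one_ne_zero (hv.symm.trans this)
  have : CompleteSpace K := FiniteDimensional.complete ℝ K
  obtain ⟨f', hfm', hf', hfy'⟩ := ih _ hrank (E := K) rfl (k := fun n t => π (k (φ n) t))
    (g := fun t => ‖π‖ * g t) (y := π y) (fun n => π.continuous.measurable.comp (hk _))
    (hg.const_mul _)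
    (fun n t => (π.le_opNorm _).trans (mul_le_mul_of_nonneg_left (hkg _ t) (norm_nonneg _)))
    (by
      simp only [fun n => π.integral_comp_comm (hki (φ n))]
      exact (π.continuous.tendsto y).comp (hy.comp hφ.tendsto_atTop))
  have hfi' : Integrable f' μ := (hg.const_mul ‖π‖).mono' hfm'.aestronglyMeasurable <|
    hf'.mono fun t ht => ht.norm_le fun n =>
      (π.le_opNorm _).trans (mul_le_mul_of_nonneg_left (hkg _ t) (norm_nonneg _))
  refine ⟨fun t => (f' t : E) + m t • v, hfm'.subtype_val.add (hmeas.smul_const v), ?_, ?_⟩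
  · filter_upwards [hf', hφlim] with t ht hmt
    obtain ⟨σ, hσ, hlim⟩ := ht
    refine ⟨fun j => φ (σ j), hφ.tendsto_atTop.comp hσ, ?_⟩
    have h := ((continuous_subtype_val.tendsto _).comp hlim).add
      ((hmt.comp hσ).smul_const v)
    refine h.congr fun j => ?_
    simp [hπ]
  · have h := K.subtypeL.integral_comp_comm hfi'
    have hfi'' : Integrable (fun t => (f' t : E)) μ := K.subtypeL.integrable_comp hfi'
    rw [integral_add hfi'' (hmi.smul_const v), integral_smul_const,
      ← hpm]
    simp only [Submodule.subtypeL_apply] at h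
    rw [h, hfy', hπ]
    simp

theorem exists_isSubseqLimit_integral_eq_of_measure_real {E : Type*} [NormedAddCommGroup E]
    [NormedSpace ℝ E] [FiniteDimensional ℝ E] [MeasurableSpace E] [BorelSpace E] {ν : Measure ℝ}
    [IsFiniteMeasure ν] {k : ℕ → ℝ → E} {g : ℝ → ℝ} {y : E} (hk : ∀ n, Measurable (k n))
    (hg : Integrable g ν) (hkg : ∀ n t, ‖k n t‖ ≤ g t)
    (hy : Tendsto (fun n => ∫ t, k n t ∂ν) atTop (𝓝 y)) :
    ∃ f : ℝ → E, Measurable f ∧ (∀ᵐ t ∂ν, IsSubseqLimit (f t) fun n => k n t) ∧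
      ∫ t, f t ∂ν = y := by
  classical
  have : ProperSpace E := FiniteDimensional.proper_real E
  let D : Set ℝ := {x | 0 < ν {x}}
  have hDc : D.Countable := Measure.countable_meas_pos_of_disjoint_iUnion
    (fun x => measurableSet_singleton x) fun x z hxz => Set.disjoint_singleton.2 hxz
  have hDm : MeasurableSet D := hDc.measurableSet
  have : Countable D := hDc.to_subtype
  obtain ⟨c, -, φ, hφ, hc⟩ := (isCompact_univ_pi fun x : D =>
    isCompact_closedBall (0 : E) (g x)).tendsto_subseq (x := fun n (x : D) => k n x)
    fun n x _ => by simpa using hkg n x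
  rw [tendsto_pi_nhds] at hc
  let f₁ : ℝ → E := fun x => if hx : x ∈ D then c ⟨x, hx⟩ else 0
  have hlim₁ : ∀ x ∈ D, Tendsto (fun n => k (φ n) x) atTop (𝓝 (f₁ x)) := fun x hx => by
    simpa [f₁, hx] using hc ⟨x, hx⟩
  have hm₁ : Measurable f₁ := by
    refine measurable_of_tendsto_metrizable (fun n => (hk (φ n)).indicator hDm)
      (tendsto_pi_nhds.2 fun x => ?_)
    by_cases hx : x ∈ D
    · simpa [hx] using hlim₁ x hx
    · simp [hx, f₁]
  have hki : ∀ n, Integrable (k n) ν := fun n =>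
    hg.mono' (hk n).aestronglyMeasurable (ae_of_all _ (hkg n))
  have hint₁ : Tendsto (fun n => ∫ x in D, k (φ n) x ∂ν) atTop (𝓝 (∫ x in D, f₁ x ∂ν)) :=
    tendsto_integral_of_dominated_convergence g (fun n => (hk _).aestronglyMeasurable)
      hg.integrableOn (fun n => ae_of_all _ (hkg _)) (ae_restrict_of_forall_mem hDm hlim₁)
  have hint₂ : Tendsto (fun n => ∫ x in Dᶜ, k (φ n) x ∂ν) atTop (𝓝 (y - ∫ x in D, f₁ x ∂ν)) := by
    refine ((hy.comp hφ.tendsto_atTop).sub hint₁).congr fun n => ?_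
    rw [Function.comp_apply, ← integral_add_compl hDm (hki (φ n)), add_sub_cancel_left]
  have : NullSingletonClass (ν.restrict Dᶜ) := ⟨fun x => by
    rw [Measure.restrict_apply (measurableSet_singleton x)]
    by_cases hx : x ∈ D
    · simp [hx]
    · exact measure_mono_null Set.inter_subset_left (by simpa [D] using hx)⟩
  obtain ⟨f₂, hm₂, hf₂, hy₂⟩ :=
    (halvesIntegrals_one_of_nullSingletonClass (ν.restrict Dᶜ)).exists_isSubseqLimit_integral_eq
      _ rfl (fun n => hk (φ n)) hg.integrableOn (fun n => hkg (φ n)) hint₂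
  have hi₁ : IntegrableOn f₁ D ν := Integrable.mono' hg.integrableOn hm₁.aestronglyMeasurable <|
    ae_restrict_of_forall_mem hDm fun x hx =>
      le_of_tendsto (hlim₁ x hx).norm (Eventually.of_forall fun n => hkg _ x)
  have hi₂ : IntegrableOn f₂ Dᶜ ν := Integrable.mono' hg.integrableOn hm₂.aestronglyMeasurable <|
    hf₂.mono fun x hx => hx.norm_le fun n => hkg _ x
  refine ⟨D.piecewise f₁ f₂, hm₁.piecewise hDm hm₂, ?_, ?_⟩
  · filter_upwards [(ae_restrict_iff' hDm.compl).1 hf₂] with x hx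
    by_cases hxD : x ∈ D
    · rw [Set.piecewise_eq_of_mem _ _ _ hxD]
      exact ⟨φ, hφ.tendsto_atTop, hlim₁ x hxD⟩
    · rw [Set.piecewise_eq_of_notMem _ _ _ hxD]
      exact (hx hxD).of_comp hφ.tendsto_atTop
  · rw [integral_piecewise hDm hi₁ hi₂, hy₂, add_sub_cancel]

/-- **Fatou's lemma in several dimensions**, dominated case. -/
theorem exists_isSubseqLimit_integral_eq {T E : Type*} [MeasurableSpace T] {μ : Measure T}
    [IsFiniteMeasure μ] [NormedAddCommGroup E] [NormedSpace ℝ E] [FiniteDimensional ℝ E]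
    [MeasurableSpace E] [BorelSpace E] {f : ℕ → T → E} {g : T → ℝ} {y : E}
    (hf : ∀ n, AEStronglyMeasurable (f n) μ) (hg : Integrable g μ)
    (hfg : ∀ n, ∀ᵐ t ∂μ, ‖f n t‖ ≤ g t)
    (hy : Tendsto (fun n => ∫ t, f n t ∂μ) atTop (𝓝 y)) :
    ∃ h : T → E, Measurable h ∧ (∀ᵐ t ∂μ, IsSubseqLimit (h t) fun n => f n t) ∧
      ∫ t, h t ∂μ = y := by
  have : ProperSpace E := FiniteDimensional.proper_real E
  let f' : ℕ → T → E := fun n => (hf n).aemeasurable.mk (f n)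
  have hfm' : ∀ n, Measurable (f' n) := fun n => (hf n).aemeasurable.measurable_mk
  have hff' : ∀ᵐ t ∂μ, ∀ n, f n t = f' n t := ae_all_iff.2 fun n => (hf n).aemeasurable.ae_eq_mk
  let g' : T → ℝ := hg.aemeasurable.mk g
  have hgm' : Measurable g' := hg.aemeasurable.measurable_mk
  have hgg' : g =ᵐ[μ] g' := hg.aemeasurable.ae_eq_mk
  let X := (ℕ → E) × ℝ
  let Φ : T → X := fun t => (fun n => f' n t, g' t)
  have hΦ : Measurable Φ := (measurable_pi_lambda _ hfm').prodMk hgm'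
  have he := measurableEmbedding_embeddingReal X
  let ψ : T → ℝ := fun t => embeddingReal X (Φ t)
  have hψ : Measurable ψ := he.measurable.comp hΦ
  obtain ⟨k, hkm, hk⟩ : ∃ k : ℕ → ℝ → E, (∀ n, Measurable (k n)) ∧ ∀ n t, k n (ψ t) = f' n t := by
    choose k hkm hk using fun n => he.exists_measurable_extend
      (g := fun x : X => x.1 n) ((measurable_pi_apply n).comp measurable_fst) fun _ => ⟨0⟩
    exact ⟨k, hkm, fun n t => congrFun (hk n) (Φ t)⟩
  obtain ⟨G, hGm, hG⟩ : ∃ G : ℝ → ℝ, Measurable G ∧ ∀ t, G (ψ t) = g' t := by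
    obtain ⟨G, hGm, hG⟩ := he.exists_measurable_extend
      (g := fun x : X => x.2) measurable_snd fun _ => ⟨0⟩
    exact ⟨G, hGm, fun t => congrFun hG (Φ t)⟩
  let R : Set ℝ := ⋂ n, {x | ‖k n x‖ ≤ G x}
  have hR : MeasurableSet R := MeasurableSet.iInter fun n => measurableSet_le (hkm n).norm hGm
  have hψR : ∀ᵐ t ∂μ, ψ t ∈ R := by
    filter_upwards [hff', hgg', ae_all_iff.2 hfg] with t h1 h2 h3
    refine Set.mem_iInter.2 fun n => ?_
    simpa [hk, hG, ← h1, ← h2] using h3 n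
  have hkR : ∀ᵐ t ∂μ, ∀ n, R.indicator (k n) (ψ t) = f n t := by
    filter_upwards [hff', hψR] with t h1 h2 n
    rw [Set.indicator_of_mem h2, hk, h1]
  obtain ⟨h, hhm, hh, hhy⟩ := exists_isSubseqLimit_integral_eq_of_measure_real
    (ν := μ.map ψ) (k := fun n => R.indicator (k n)) (g := R.indicator G) (y := y)
    (fun n => (hkm n).indicator hR)
    ((integrable_map_measure (hGm.indicator hR).aestronglyMeasurable hψ.aemeasurable).2 <|
      hg.congr <| by
        filter_upwards [hgg', hψR] with t h1 h2
        rw [Function.comp_apply, Set.indicator_of_mem h2, hG, h1])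
    (fun n x => by
      by_cases hx : x ∈ R
      · simpa [hx] using Set.mem_iInter.1 hx n
      · simp [hx])
    (hy.congr fun n => by
      rw [integral_map hψ.aemeasurable ((hkm n).indicator hR).aestronglyMeasurable]
      exact integral_congr_ae (hkR.mono fun t ht => (ht n).symm))
  refine ⟨fun t => h (ψ t), hhm.comp hψ, ?_, ?_⟩
  · filter_upwards [ae_of_ae_map hψ.aemeasurable hh, hkR] with t h1 h2
    simpa only [h2] using h1
  · rw [← hhy, integral_map hψ.aemeasurable hhm.aestronglyMeasurable]

/-- The Aumann integral of a nonempty closed-valued, lower measurable, integrably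
bounded correspondence over a finite measure space is nonempty and compact. -/
theorem aumannIntegral_nonempty_compact {ℓ : ℕ} {T : Type*} [MeasurableSpace T]
    (μ : Measure T) [IsFiniteMeasure μ]
    (F : T → Set (Fin ℓ → ℝ)) (hne : ∀ t, (F t).Nonempty) (hcl : ∀ t, IsClosed (F t))
    (hlm : ∀ V : Set (Fin ℓ → ℝ), IsOpen V → MeasurableSet {t | (F t ∩ V).Nonempty})
    (g : T → ℝ) (hg : Integrable g μ) (hbd : ∀ t, ∀ x ∈ F t, ‖x‖ ≤ g t) :
    (aumannIntegral μ F).Nonempty ∧ IsCompact (aumannIntegral μ F) := by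
  have hint : ∀ f : T → Fin ℓ → ℝ, AEStronglyMeasurable f μ → (∀ᵐ t ∂μ, f t ∈ F t) →
      Integrable f μ := fun f hf hfF => hg.mono' hf (hfF.mono fun t ht => hbd t _ ht)
  constructor
  · obtain ⟨f, hfm, hf⟩ := exists_measurable_selection hne hcl hlm fun t => ⟨g t, hbd t⟩
    exact ⟨_, f, hint f hfm.aestronglyMeasurable (ae_of_all _ hf), ae_of_all _ hf, rfl⟩
  · refine Metric.isCompact_of_isClosed_isBounded ?_ ?_
    · refine IsSeqClosed.isClosed fun z y hz hy => ?_
      choose f hfi hfF hfz using hz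
      obtain ⟨h, hhm, hh, hhy⟩ := exists_isSubseqLimit_integral_eq
        (fun n => (hfi n).aestronglyMeasurable) hg
        (fun n => (hfF n).mono fun t ht => hbd t _ ht) (by simpa only [hfz] using hy)
      have hhF : ∀ᵐ t ∂μ, h t ∈ F t := by
        filter_upwards [hh, ae_all_iff.2 hfF] with t h1 h2
        exact h1.mem_of_isClosed (hcl t) h2
      exact ⟨h, hint h hhm.aestronglyMeasurable hhF, hhF, hhy⟩
    · refine (Metric.isBounded_closedBall (x := 0) (r := ∫ t, g t ∂μ)).subset ?_
      rintro _ ⟨f, -, hfF, rfl⟩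
      rw [mem_closedBall_zero_iff]
      exact norm_integral_le_of_norm_le hg (hfF.mono fun t ht => hbd t _ ht)
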